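/- arXiv:2410.24040 — 5 statements merged into one kernel-verified Lean document; each statement's English description precedes it below -/
import Mathlib

section
/- Let V be a Banach space, p > 0, ω̄ a control on Δ_T and L > 0. Let g : Δ_T → V be a continuous two-index function with g(s,s) = 0 for all s ∈ [0,T] and with finite localized p-variation ‖g‖_{p,(ω̄,L),[0,T]} < ∞. Then the function ω_g : Δ_T → [0,∞) defined by ω_g(s,t) := ‖g‖_{p,(ω̄,L),[s,t]}^p is a control, i.e. it is continuous on Δ_T, vanishes on the diagonal, and is superadditive. The same conclusion holds for a continuous one-index function g : [0,T] → V with finite localized p-variation, where increments g(s,t) := g(t) − g(s) are used. -/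
open Set

/-- The simplex `Δ_T = {(s,t) : 0 ≤ s ≤ t ≤ T}`. -/
def Simplex (T : ℝ) : Set (ℝ × ℝ) := {q | 0 ≤ q.1 ∧ q.1 ≤ q.2 ∧ q.2 ≤ T}

/-- A control on `Δ_T`: a continuous nonnegative function vanishing on the diagonal
and superadditive. -/
structure IsControl (T : ℝ) (ω : ℝ → ℝ → ℝ) : Prop where
  nonneg : ∀ ⦃s t : ℝ⦄, 0 ≤ s → s ≤ t → t ≤ T → 0 ≤ ω s t
  cont : ContinuousOn (fun q : ℝ × ℝ => ω q.1 q.2) (Simplex T)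
  diag : ∀ ⦃s : ℝ⦄, 0 ≤ s → s ≤ T → ω s s = 0
  superadd : ∀ ⦃s u t : ℝ⦄, 0 ≤ s → s ≤ u → u ≤ t → t ≤ T → ω s u + ω u t ≤ ω s t

/-- A control is strictly positive if it vanishes only on the diagonal. -/
def StrictlyPositive (T : ℝ) (ω : ℝ → ℝ → ℝ) : Prop :=
  ∀ ⦃s t : ℝ⦄, 0 ≤ s → s ≤ t → t ≤ T → ω s t = 0 → s = t

/-- `τ 0 = s < τ 1 < ⋯ < τ N = t` is a partition of `[s,t]`. -/
def IsPartition (s t : ℝ) (N : ℕ) (τ : ℕ → ℝ) : Prop :=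
  τ 0 = s ∧ τ N = t ∧ ∀ i < N, τ i < τ (i + 1)

/-- A partition is `(ω̄,L)`-admissible if `ω̄(τ i, τ (i+1)) ≤ L` for every step. -/
def IsAdmissible (ωb : ℝ → ℝ → ℝ) (L : ℝ) (N : ℕ) (τ : ℕ → ℝ) : Prop :=
  ∀ i < N, ωb (τ i) (τ (i + 1)) ≤ L

/-- The `p`-sum of the two-index function `g` along a partition. -/
noncomputable def pSum {V : Type*} [NormedAddCommGroup V]
    (g : ℝ → ℝ → V) (p : ℝ) (N : ℕ) (τ : ℕ → ℝ) : ℝ :=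
  ∑ i ∈ Finset.range N, ‖g (τ i) (τ (i + 1))‖ ^ p

/-- Increments of a one-index function, viewed as a two-index function. -/
def inc {V : Type*} [NormedAddCommGroup V] (f : ℝ → V) : ℝ → ℝ → V :=
  fun a b => f b - f a

/-- The set of `p`-sums of `g` along `(ω̄,L)`-admissible partitions of `[s,t]`. -/
def locVarSet {V : Type*} [NormedAddCommGroup V] (g : ℝ → ℝ → V) (p : ℝ)
    (ωb : ℝ → ℝ → ℝ) (L s t : ℝ) : Set ℝ :=
  {x | ∃ N τ, IsPartition s t N τ ∧ IsAdmissible ωb L N τ ∧ x = pSum g p N τ}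

/-- The localized `p`-variation `‖g‖_{p,(ω̄,L),[s,t]}^p` (raised to the `p`-th power). -/
noncomputable def locVar {V : Type*} [NormedAddCommGroup V] (g : ℝ → ℝ → V) (p : ℝ)
    (ωb : ℝ → ℝ → ℝ) (L s t : ℝ) : ℝ :=
  sSup (locVarSet g p ωb L s t)

/-- The set of `p`-sums of `g` along arbitrary partitions of `[s,t]`. -/
def varSet {V : Type*} [NormedAddCommGroup V] (g : ℝ → ℝ → V) (p : ℝ) (s t : ℝ) : Set ℝ :=
  {x | ∃ N τ, IsPartition s t N τ ∧ x = pSum g p N τ}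

/-- The (unlocalized) `p`-variation `‖g‖_{p,[s,t]}^p` (raised to the `p`-th power). -/
noncomputable def pVar {V : Type*} [NormedAddCommGroup V] (g : ℝ → ℝ → V) (p : ℝ)
    (s t : ℝ) : ℝ :=
  sSup (varSet g p s t)

/-- `AdmissibleSum w ωb L a b v`: some partition of `[a,b]` with all steps of `ωb`-size at most `L`
has `w`-sum equal to `v`. -/
inductive AdmissibleSum (w ωb : ℝ → ℝ → ℝ) (L : ℝ) : ℝ → ℝ → ℝ → Prop
  | nil (a : ℝ) : AdmissibleSum w ωb L a a 0
  | cons {a c b v : ℝ} : a < c → ωb a c ≤ L → AdmissibleSum w ωb L c b v →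
      AdmissibleSum w ωb L a b (w a c + v)

theorem IsControl.mono {T : ℝ} {ω : ℝ → ℝ → ℝ} (h : IsControl T ω) {a x y b : ℝ}
    (ha : 0 ≤ a) (hax : a ≤ x) (hxy : x ≤ y) (hyb : y ≤ b) (hb : b ≤ T) : ω x y ≤ ω a b := by
  have h1 := h.superadd ha hax (hxy.trans hyb) hb
  have h2 := h.superadd (ha.trans hax) hxy hyb hb
  have h3 := h.nonneg ha hax (by linarith)
  have h4 := h.nonneg (by linarith) hyb hb
  linarith

theorem isCompact_simplex (T : ℝ) : IsCompact (Simplex T) := by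
  refine (isCompact_Icc.prod isCompact_Icc : IsCompact (Icc 0 T ×ˢ Icc 0 T)).of_isClosed_subset
    ?_ ?_
  · exact (isClosed_le continuous_const continuous_fst).inter
      ((isClosed_le continuous_fst continuous_snd).inter
        (isClosed_le continuous_snd continuous_const))
  · rintro ⟨a, b⟩ ⟨h1, h2, h3⟩
    exact ⟨⟨h1, h2.trans h3⟩, ⟨h1.trans h2, h3⟩⟩

theorem exists_modulus {T : ℝ} {w : ℝ → ℝ → ℝ}
    (hw : ContinuousOn (fun q : ℝ × ℝ => w q.1 q.2) (Simplex T)) {ε : ℝ} (hε : 0 < ε) :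
    ∃ δ > 0, ∀ a b c d : ℝ, 0 ≤ a → a ≤ b → b ≤ T → 0 ≤ c → c ≤ d → d ≤ T →
      |a - c| < δ → |b - d| < δ → |w a b - w c d| < ε := by
  obtain ⟨δ, hδ, h⟩ := Metric.uniformContinuousOn_iff.1
    ((isCompact_simplex T).uniformContinuousOn_of_continuous hw) ε hε
  refine ⟨δ, hδ, fun a b c d ha hab hb hc hcd hd h1 h2 => ?_⟩
  exact h (a, b) ⟨ha, hab, hb⟩ (c, d) ⟨hc, hcd, hd⟩ (max_lt h1 h2)

theorem mem_locVarSet_iff {V : Type*} [NormedAddCommGroup V] {g : ℝ → ℝ → V} {p : ℝ}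
    {ωb : ℝ → ℝ → ℝ} {L s t v : ℝ} :
    v ∈ locVarSet g p ωb L s t ↔ AdmissibleSum (fun a b => ‖g a b‖ ^ p) ωb L s t v := by
  constructor
  · rintro ⟨N, τ, ⟨h0, hN, hlt⟩, hadm, rfl⟩
    induction N generalizing s τ with
    | zero =>
      obtain rfl : s = t := h0.symm.trans hN
      simpa [pSum] using AdmissibleSum.nil s
    | succ N ih =>
      have hrest := ih (s := τ 1) (fun i => τ (i + 1)) rfl hN
        (fun i hi => hlt (i + 1) (by omega)) (fun i hi => hadm (i + 1) (by omega))
      have hcons := AdmissibleSum.cons (hlt 0 (by omega)) (hadm 0 (by omega)) hrest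
      rw [h0] at hcons
      convert hcons using 1
      simp only [pSum, Finset.sum_range_succ', h0, zero_add]
      ring
  · intro h
    induction h with
    | nil a => exact ⟨0, fun _ => a, ⟨rfl, rfl, by simp⟩, by simp [IsAdmissible], by simp [pSum]⟩
    | @cons a c b v hac hL _ ih =>
      obtain ⟨N, τ, ⟨h0, hN, hlt⟩, hadm, rfl⟩ := ih
      refine ⟨N + 1, fun i => Nat.casesOn i a τ, ⟨rfl, hN, ?_⟩, ?_, ?_⟩
      · rintro (_ | i) hi
        · simpa [h0] using hac
        · exact hlt i (by omega)
      · rintro (_ | i) hi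
        · simpa [h0] using hL
        · exact hadm i (by omega)
      · simp only [pSum, Finset.sum_range_succ', h0]
        exact add_comm _ _

namespace AdmissibleSum

variable {w ωb : ℝ → ℝ → ℝ} {L a b c v : ℝ}

theorem le (h : AdmissibleSum w ωb L a b v) : a ≤ b := by
  induction h with
  | nil => exact le_rfl
  | cons h1 _ _ ih => exact h1.le.trans ih

theorem nonneg (hw : ∀ x y, 0 ≤ w x y) (h : AdmissibleSum w ωb L a b v) : 0 ≤ v := by
  induction h with
  | nil => exact le_rfl
  | cons _ _ _ ih => exact add_nonneg (hw _ _) ih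

theorem single (h : a < b) (hL : ωb a b ≤ L) : AdmissibleSum w ωb L a b (w a b) := by
  simpa using cons (w := w) h hL (nil b)

theorem append {u : ℝ} (h : AdmissibleSum w ωb L a b u) (h' : AdmissibleSum w ωb L b c v) :
    AdmissibleSum w ωb L a c (u + v) := by
  induction h with
  | nil => simpa using h'
  | cons h1 h2 _ ih => simpa only [add_assoc] using cons h1 h2 (ih h')

theorem eq_zero_of_diag (h : AdmissibleSum w ωb L a a v) : v = 0 := by
  cases h with
  | nil => rfl
  | cons h1 _ h3 => exact absurd h3.le (not_le.2 h1)

/-- A partition of a nondegenerate interval has a last step. -/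
theorem exists_last (h : AdmissibleSum w ωb L a b v) (hab : a < b) :
    ∃ c u, AdmissibleSum w ωb L a c u ∧ c < b ∧ v = u + w c b := by
  induction h with
  | nil => exact absurd hab (lt_irrefl _)
  | @cons a c b v h1 h2 h3 ih =>
    rcases h3.le.eq_or_lt with rfl | hcb
    · refine ⟨a, 0, nil a, h1, ?_⟩
      rw [h3.eq_zero_of_diag]
      ring
    · obtain ⟨d, u, hu, hd, rfl⟩ := ih hcb
      exact ⟨d, w a c + u, cons h1 h2 hu, hd, by ring⟩

/-- Cutting a partition at `z` costs at most the defect of the step straddling `z`. -/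
theorem split {T x y z η : ℝ} (hωb : IsControl T ωb) (hη : 0 ≤ η)
    (h : AdmissibleSum w ωb L x y v) (hx : 0 ≤ x) (hxz : x ≤ z) (hzy : z ≤ y) (hy : y ≤ T)
    (hw : ∀ a b, x ≤ a → a ≤ z → z ≤ b → b ≤ y → w a b ≤ w a z + w z b + η) :
    ∃ u₁ u₂, AdmissibleSum w ωb L x z u₁ ∧ AdmissibleSum w ωb L z y u₂ ∧ v ≤ u₁ + u₂ + η := by
  induction h with
  | nil a =>
    obtain rfl := le_antisymm hxz hzy
    exact ⟨0, 0, nil _, nil _, by simpa using hη⟩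
  | @cons x c y v h1 h2 h3 ih =>
    rcases le_or_gt c z with hcz | hzc
    · obtain ⟨u₁, u₂, hu₁, hu₂, hv⟩ := ih (hx.trans h1.le) hcz hzy hy
        (fun a b ha => hw a b (h1.le.trans ha))
      exact ⟨w x c + u₁, u₂, cons h1 h2 hu₁, hu₂, by linarith⟩
    · have hcT := h3.le.trans hy
      rcases hxz.eq_or_lt with rfl | hxz
      · exact ⟨0, _, nil _, cons h1 h2 h3, by linarith⟩
      · refine ⟨w x z, w z c + v, single hxz ?_, cons hzc ?_ h3, ?_⟩
        · exact (hωb.mono hx le_rfl hxz.le hzc.le hcT).trans h2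
        · exact (hωb.mono hx hxz.le hzc.le le_rfl hcT).trans h2
        · linarith [hw x c le_rfl hxz.le hzc.le h3.le]

theorem exists_of_le {T s t : ℝ} (w : ℝ → ℝ → ℝ) (hωb : IsControl T ωb) (hL : 0 < L)
    (hs : 0 ≤ s) (hst : s ≤ t) (ht : t ≤ T) : ∃ v, AdmissibleSum w ωb L s t v := by
  obtain ⟨δ, hδ, hmod⟩ := exists_modulus hωb.cont hL
  have hsmall : ∀ a b, 0 ≤ a → a ≤ b → b ≤ T → b - a < δ → ωb a b ≤ L := by
    intro a b ha hab hb hba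
    have := hmod a b a a ha hab hb ha le_rfl (hab.trans hb) (by simpa using hδ)
      (by rwa [abs_of_nonneg (sub_nonneg.2 hab)])
    rw [hωb.diag ha (hab.trans hb), sub_zero] at this
    exact (le_abs_self _).trans this.le
  have key : ∀ (n : ℕ) (s : ℝ), 0 ≤ s → s ≤ t → t - s ≤ n * (δ / 2) →
      ∃ v, AdmissibleSum w ωb L s t v := by
    intro n
    induction n with
    | zero =>
      intro s _ hst h
      obtain rfl : s = t := by
        simp only [Nat.cast_zero, zero_mul] at h
        linarith
      exact ⟨0, nil s⟩
    | succ n ih =>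
      intro s hs hst h
      push_cast at h
      rcases hst.eq_or_lt with rfl | hst'
      · exact ⟨0, nil s⟩
      rcases le_or_gt t (s + δ / 2) with hle | hgt
      · exact ⟨_, single hst' (hsmall s t hs hst ht (by linarith))⟩
      · obtain ⟨v, hv⟩ := ih (s + δ / 2) (by linarith) hgt.le (by linarith)
        exact ⟨_, cons (by linarith)
          (hsmall s (s + δ / 2) hs (by linarith) (by linarith) (by linarith)) hv⟩
  obtain ⟨n, hn⟩ := exists_nat_ge ((t - s) / (δ / 2))
  exact key n s hs hst ((div_le_iff₀ (by linarith)).1 hn)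

end AdmissibleSum

/-- A function `W` which is the least upper bound of the admissible sums of a continuous
nonnegative `w` vanishing on the diagonal is a control. -/
theorem isControl_of_isLUB_admissibleSum {T L : ℝ} {w ωb W : ℝ → ℝ → ℝ}
    (hωb : IsControl T ωb) (hw0 : ∀ a b, 0 ≤ w a b)
    (hwc : ContinuousOn (fun q : ℝ × ℝ => w q.1 q.2) (Simplex T))
    (hwd : ∀ s, 0 ≤ s → s ≤ T → w s s = 0)
    (hW : ∀ s t, 0 ≤ s → s ≤ t → t ≤ T → IsLUB {v | AdmissibleSum w ωb L s t v} (W s t)) :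
    IsControl T W := by
  have nonneg : ∀ s t, 0 ≤ s → s ≤ t → t ≤ T → 0 ≤ W s t := by
    intro s t hs hst ht
    by_contra! hneg
    have : W s t ≤ W s t - 1 := (hW s t hs hst ht).2 fun v hv => by
      linarith [(hW s t hs hst ht).1 hv, AdmissibleSum.nonneg hw0 hv]
    linarith
  have diag : ∀ s, 0 ≤ s → s ≤ T → W s s = 0 := by
    intro s hs hsT
    refine le_antisymm ((hW s s hs le_rfl hsT).2 fun v hv => ?_) (nonneg s s hs le_rfl hsT)
    exact (AdmissibleSum.eq_zero_of_diag hv).le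
  have superadd : ∀ s u t, 0 ≤ s → s ≤ u → u ≤ t → t ≤ T → W s u + W u t ≤ W s t := by
    intro s u t hs hsu hut ht
    have h1 : W s u ≤ W s t - W u t := (hW s u hs hsu (hut.trans ht)).2 fun v hv => by
      have h2 : W u t ≤ W s t - v := (hW u t (hs.trans hsu) hut ht).2 fun v' hv' => by
        linarith [(hW s t hs (hsu.trans hut) ht).1 (AdmissibleSum.append hv hv')]
      linarith
    linarith
  have mono : ∀ a x y b, 0 ≤ a → a ≤ x → x ≤ y → y ≤ b → b ≤ T → W x y ≤ W a b := by
    intro a x y b ha hax hxy hyb hb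
    linarith [superadd a x b ha hax (hxy.trans hyb) hb,
      superadd x y b (ha.trans hax) hxy hyb hb, nonneg a x ha hax (by linarith),
      nonneg y b (by linarith) hyb hb]
  have split : ∀ x z y η, 0 ≤ x → x ≤ z → z ≤ y → y ≤ T → 0 ≤ η →
      (∀ a b, x ≤ a → a ≤ z → z ≤ b → b ≤ y → w a b ≤ w a z + w z b + η) →
      W x y ≤ W x z + W z y + η := by
    intro x z y η hx hxz hzy hy hη hw
    refine (hW x y hx (hxz.trans hzy) hy).2 fun v hv => ?_
    obtain ⟨u₁, u₂, h1, h2, h3⟩ := AdmissibleSum.split hωb hη hv hx hxz hzy hy hw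
    linarith [(hW x z hx hxz (hzy.trans hy)).1 h1, (hW z y (hx.trans hxz) hzy hy).1 h2]
  have right_small : ∀ t ε, 0 ≤ t → 0 < ε →
      ∃ δ > 0, ∀ y, t ≤ y → y ≤ T → y - t < δ → W t y ≤ ε := by
    intro t ε ht hε
    by_contra! hcon
    have hlarge : ∀ y, t < y → y ≤ T → ε < W t y := by
      intro y hty hy
      obtain ⟨y', h1, h2, h3, h4⟩ := hcon (y - t) (by linarith)
      exact h4.trans_le (mono t t y' y ht le_rfl h1 (by linarith) hy)
    obtain ⟨δ, hδ, hmod⟩ := exists_modulus hwc (half_pos hε)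
    obtain ⟨y, h1, h2, h3, h4⟩ := hcon δ hδ
    obtain ⟨v, hv, hlt, -⟩ := (hW t y ht h1 h2).exists_between
      (show W t y - ε / 2 < W t y by linarith)
    cases hv with
    | nil => linarith [diag t ht h2]
    | @cons _ c _ v' htc _ hv' =>
      have hcy := hv'.le
      have hcT := hcy.trans h2
      have hsm := hmod t c t t ht htc.le hcT ht le_rfl (htc.le.trans hcT) (by simpa using hδ)
        (by rw [abs_of_nonneg] <;> linarith)
      rw [hwd t ht (htc.le.trans hcT), sub_zero, abs_of_nonneg (hw0 _ _)] at hsm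
      linarith [superadd t c y ht htc.le hcy h2, hlarge c htc hcT,
        (hW c y (by linarith) hcy h2).1 hv']
  have left_small : ∀ t ε, t ≤ T → 0 < ε →
      ∃ δ > 0, ∀ x, 0 ≤ x → x ≤ t → t - x < δ → W x t ≤ ε := by
    intro t ε ht hε
    by_contra! hcon
    have hlarge : ∀ x, 0 ≤ x → x < t → ε < W x t := by
      intro x hx hxt
      obtain ⟨x', h1, h2, h3, h4⟩ := hcon (t - x) (by linarith)
      exact h4.trans_le (mono x x' t t hx (by linarith) h2 le_rfl ht)
    obtain ⟨δ, hδ, hmod⟩ := exists_modulus hwc (half_pos hε)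
    obtain ⟨x, h1, h2, h3, h4⟩ := hcon δ hδ
    have h0t : 0 ≤ t := h1.trans h2
    have hxt : x < t := h2.lt_of_ne (by
      rintro rfl
      linarith [diag x h1 ht])
    obtain ⟨v, hv, hlt, -⟩ := (hW x t h1 h2 ht).exists_between
      (show W x t - ε / 2 < W x t by linarith)
    obtain ⟨c, u, hu, hct, rfl⟩ := AdmissibleSum.exists_last hv hxt
    have hxc := hu.le
    have hsm := hmod c t t t (h1.trans hxc) hct.le ht h0t le_rfl ht
      (by rw [abs_sub_comm, abs_of_nonneg] <;> linarith) (by simpa using hδ)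
    rw [hwd t h0t ht, sub_zero, abs_of_nonneg (hw0 _ _)] at hsm
    linarith [superadd x c t h1 hxc hct.le ht, hlarge c (h1.trans hxc) hct,
      (hW x c h1 hxc (hct.le.trans ht)).1 hu]
  refine ⟨fun s t => nonneg s t, ?_, fun s => diag s, fun s u t => superadd s u t⟩
  rw [Metric.continuousOn_iff]
  rintro ⟨s, t⟩ ⟨hs, hst, ht⟩ ε hε
  dsimp only at hs hst ht
  have hε5 : 0 < ε / 5 := by linarith
  have hsT := hst.trans ht
  have h0t := hs.trans hst
  obtain ⟨δ₀, hδ₀, hmod⟩ := exists_modulus hwc hε5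
  obtain ⟨δ₁, hδ₁, hr_s⟩ := right_small s (ε / 5) hs hε5
  obtain ⟨δ₂, hδ₂, hr_t⟩ := right_small t (ε / 5) h0t hε5
  obtain ⟨δ₃, hδ₃, hl_s⟩ := left_small s (ε / 5) hsT hε5
  obtain ⟨δ₄, hδ₄, hl_t⟩ := left_small t (ε / 5) ht hε5
  obtain ⟨δ, hδ, hd₀, hd₁, hd₂, hd₃, hd₄⟩ : ∃ δ > 0, δ ≤ δ₀ ∧ δ ≤ δ₁ ∧ δ ≤ δ₂ ∧ δ ≤ δ₃ ∧ δ ≤ δ₄ :=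
    ⟨min δ₀ (min δ₁ (min δ₂ (min δ₃ δ₄))), by positivity, by simp⟩
  have cut_left : ∀ x z y, 0 ≤ x → x ≤ z → z ≤ y → y ≤ T → z - x < δ →
      W x y ≤ W x z + W z y + ε / 5 := by
    intro x z y hx hxz hzy hy hlt
    refine split x z y _ hx hxz hzy hy hε5.le fun a b ha haz hzb hb => ?_
    have := hmod a b z b (by linarith) (by linarith) (by linarith) (by linarith) hzb (by linarith)
      (by rw [abs_sub_comm, abs_of_nonneg] <;> linarith) (by simpa using hδ₀)
    linarith [(abs_lt.1 this).2, hw0 a z]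
  have cut_right : ∀ x z y, 0 ≤ x → x ≤ z → z ≤ y → y ≤ T → y - z < δ →
      W x y ≤ W x z + W z y + ε / 5 := by
    intro x z y hx hxz hzy hy hlt
    refine split x z y _ hx hxz hzy hy hε5.le fun a b ha haz hzb hb => ?_
    have := hmod a b a z (by linarith) (by linarith) (by linarith) (by linarith) haz (by linarith)
      (by simpa using hδ₀) (by rw [abs_of_nonneg] <;> linarith)
    linarith [(abs_lt.1 this).2, hw0 z b]
  refine ⟨δ, hδ, ?_⟩
  rintro ⟨s', t'⟩ ⟨hs', hst', ht'⟩ hdist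
  dsimp only at hs' hst' ht' ⊢
  obtain ⟨hds, hdt⟩ := max_lt_iff.1 hdist
  simp only [Real.dist_eq, abs_lt] at hds hdt
  rw [Real.dist_eq, abs_lt]
  constructor
  · rcases lt_or_ge t s' with hts' | hts'
    · linarith [mono s s t s' hs le_rfl hst hts'.le (by linarith), nonneg s' t' hs' hst' ht',
        hr_s s' (by linarith) (by linarith) (by linarith)]
    rcases lt_or_ge t' s with hts | hts
    · linarith [mono t' s t t (by linarith) hts.le hst le_rfl ht, nonneg s' t' hs' hst' ht',
        hl_t t' (by linarith) (by linarith) (by linarith)]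
    obtain ⟨x, hsx, hs'x, hxt, hxt', hxδ⟩ :
        ∃ x, s ≤ x ∧ s' ≤ x ∧ x ≤ t ∧ x ≤ t' ∧ x - s < δ :=
      ⟨max s s', le_max_left _ _, le_max_right _ _, max_le hst hts', max_le hts hst',
        by rcases max_cases s s' with h | h <;> linarith⟩
    obtain ⟨y, hyt, hyt', hxy, hyδ⟩ : ∃ y, y ≤ t ∧ y ≤ t' ∧ x ≤ y ∧ t - y < δ :=
      ⟨min t t', min_le_left _ _, min_le_right _ _, le_min hxt hxt',
        by rcases min_cases t t' with h | h <;> linarith⟩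
    linarith [cut_left s x t hs hsx hxt ht hxδ, cut_right x y t (by linarith) hxy hyt ht hyδ,
      mono s' x y t' hs' hs'x hxy hyt' ht', hr_s x hsx (by linarith) (by linarith),
      hl_t y (by linarith) hyt (by linarith)]
  · obtain ⟨x, hx, hxs, hxs', hxδ⟩ : ∃ x, 0 ≤ x ∧ x ≤ s ∧ x ≤ s' ∧ s - x < δ :=
      ⟨min s s', le_min hs hs', min_le_left _ _, min_le_right _ _,
        by rcases min_cases s s' with h | h <;> linarith⟩
    obtain ⟨y, hy, hty, hty', hyδ⟩ : ∃ y, y ≤ T ∧ t ≤ y ∧ t' ≤ y ∧ y - t < δ :=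
      ⟨max t t', max_le ht ht', le_max_left _ _, le_max_right _ _,
        by rcases max_cases t t' with h | h <;> linarith⟩
    linarith [cut_left x s y hx hxs (hst.trans hty) hy hxδ, cut_right s t y hs hst hty hy hyδ,
      mono x s' t' y hx hxs' hst' hty' hy, hl_s x hx hxs (by linarith),
      hr_t y hty hy (by linarith)]

theorem isControl_locVar {V : Type*} [NormedAddCommGroup V] {T p L : ℝ} (hp : 0 < p)
    {ωb : ℝ → ℝ → ℝ} (hωb : IsControl T ωb) (hL : 0 < L) {g : ℝ → ℝ → V}
    (hgc : ContinuousOn (fun q : ℝ × ℝ => g q.1 q.2) (Simplex T))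
    (hgd : ∀ s : ℝ, 0 ≤ s → s ≤ T → g s s = 0)
    (hgfin : BddAbove (locVarSet g p ωb L 0 T)) :
    IsControl T (fun s t => locVar g p ωb L s t) := by
  have hw0 : ∀ a b, 0 ≤ ‖g a b‖ ^ p := fun a b => by positivity
  refine isControl_of_isLUB_admissibleSum (w := fun a b => ‖g a b‖ ^ p) (L := L) hωb hw0
    (hgc.norm.rpow_const fun _ _ => Or.inr hp.le)
    (fun s hs hsT => by simp [hgd s hs hsT, Real.zero_rpow hp.ne']) fun s t hs hst ht => ?_
  have hset : {v | AdmissibleSum (fun a b => ‖g a b‖ ^ p) ωb L s t v} = locVarSet g p ωb L s t :=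
    Set.ext fun v => mem_locVarSet_iff.symm
  rw [hset]
  refine isLUB_csSup ?_ ?_
  · obtain ⟨v, hv⟩ := AdmissibleSum.exists_of_le (fun a b => ‖g a b‖ ^ p) hωb hL hs hst ht
    exact ⟨v, mem_locVarSet_iff.2 hv⟩
  · obtain ⟨B, hB⟩ := hgfin
    obtain ⟨u, hu⟩ := AdmissibleSum.exists_of_le (fun a b => ‖g a b‖ ^ p) hωb hL le_rfl hs
      (hst.trans ht)
    obtain ⟨u', hu'⟩ := AdmissibleSum.exists_of_le (fun a b => ‖g a b‖ ^ p) hωb hL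
      (hs.trans hst) ht le_rfl
    refine ⟨B, fun v hv => ?_⟩
    have := hB (mem_locVarSet_iff.2 (hu.append ((mem_locVarSet_iff.1 hv).append hu')))
    linarith [hu.nonneg hw0, hu'.nonneg hw0]

/-- If `g` is a continuous two-index (resp. one-index) function with
finite localized `p`-variation with respect to `(ω̄, L)`, then
`ω_g(s,t) := ‖g‖_{p,(ω̄,L),[s,t]}^p` is a control. -/
theorem statement0 {V : Type*} [NormedAddCommGroup V] [NormedSpace ℝ V] [CompleteSpace V]
    (T : ℝ) (hT : 0 < T) (p : ℝ) (hp : 0 < p)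
    (ωb : ℝ → ℝ → ℝ) (hωb : IsControl T ωb) (L : ℝ) (hL : 0 < L)
    (g : ℝ → ℝ → V)
    (hgc : ContinuousOn (fun q : ℝ × ℝ => g q.1 q.2) (Simplex T))
    (hgd : ∀ s : ℝ, 0 ≤ s → s ≤ T → g s s = 0)
    (hgfin : BddAbove (locVarSet g p ωb L 0 T))
    (f : ℝ → V) (hfc : ContinuousOn f (Icc 0 T))
    (hffin : BddAbove (locVarSet (inc f) p ωb L 0 T)) :
    IsControl T (fun s t => locVar g p ωb L s t) ∧
    IsControl T (fun s t => locVar (inc f) p ωb L s t) := by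
  refine ⟨isControl_locVar hp hωb hL hgc hgd hgfin, isControl_locVar hp hωb hL ?_ ?_ hffin⟩
  · exact (hfc.comp continuousOn_snd fun q hq => ⟨hq.1.trans hq.2.1, hq.2.2⟩).sub
      (hfc.comp continuousOn_fst fun q hq => ⟨hq.1, hq.2.1.trans hq.2.2⟩)
  · intro s _ _
    exact sub_self (f s)
end

section
/- Let V be a Banach space, p > 0, ω̄ a control on Δ_T and L > 0. Let g : Δ_T → V be a continuous two-index function with g(s,s) = 0 for all s and finite localized p-variation with respect to (ω̄,L), and set ω_g(s,t) := ‖g‖_{p,(ω̄,L),[s,t]}^p. Then: (i) ‖g(s,t)‖ ≤ ω_g(s,t)^{1/p} for all (s,t) ∈ Δ_T with ω̄(s,t) ≤ L; and (ii) ω_g is the smallest control with this property, i.e. if ω is any control satisfying ‖g(s,t)‖ ≤ ω(s,t)^{1/p} for all (s,t) ∈ Δ_T with ω̄(s,t) ≤ L, then ω_g(u,v) ≤ ω(u,v) for all (u,v) ∈ Δ_T. -/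
open Set

theorem IsPartition.mono {s t : ℝ} {N : ℕ} {τ : ℕ → ℝ} (h : IsPartition s t N τ)
    {i j : ℕ} (hij : i ≤ j) (hj : j ≤ N) : τ i ≤ τ j := by
  induction j, hij using Nat.le_induction with
  | base => exact le_rfl
  | succ k _ ih => exact (ih (by omega)).trans (h.2.2 k (by omega)).le

theorem IsPartition.left_le {s t : ℝ} {N : ℕ} {τ : ℕ → ℝ} (h : IsPartition s t N τ)
    {i : ℕ} (hi : i ≤ N) : s ≤ τ i :=
  h.1 ▸ h.mono (Nat.zero_le i) hi

theorem IsPartition.le_right {s t : ℝ} {N : ℕ} {τ : ℕ → ℝ} (h : IsPartition s t N τ)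
    {i : ℕ} (hi : i ≤ N) : τ i ≤ t :=
  h.2.1 ▸ h.mono hi le_rfl

theorem pSum_nonneg {V : Type*} [NormedAddCommGroup V] (g : ℝ → ℝ → V) (p : ℝ) (N : ℕ)
    (τ : ℕ → ℝ) : 0 ≤ pSum g p N τ :=
  Finset.sum_nonneg fun _ _ => Real.rpow_nonneg (norm_nonneg _) _

theorem nonneg_of_mem_locVarSet {V : Type*} [NormedAddCommGroup V] {g : ℝ → ℝ → V} {p : ℝ}
    {ωb : ℝ → ℝ → ℝ} {L s t x : ℝ} (hx : x ∈ locVarSet g p ωb L s t) : 0 ≤ x := by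
  obtain ⟨N, τ, -, -, rfl⟩ := hx
  exact pSum_nonneg g p N τ

theorem locVar_nonneg {V : Type*} [NormedAddCommGroup V] (g : ℝ → ℝ → V) (p : ℝ)
    (ωb : ℝ → ℝ → ℝ) (L s t : ℝ) : 0 ≤ locVar g p ωb L s t :=
  Real.sSup_nonneg fun _ hx => nonneg_of_mem_locVarSet hx

/-- Admissible partitions of adjacent intervals can be concatenated. -/
theorem add_mem_locVarSet {V : Type*} [NormedAddCommGroup V] {g : ℝ → ℝ → V} {p : ℝ}
    {ωb : ℝ → ℝ → ℝ} {L s u t x y : ℝ} (hx : x ∈ locVarSet g p ωb L s u)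
    (hy : y ∈ locVarSet g p ωb L u t) : x + y ∈ locVarSet g p ωb L s t := by
  obtain ⟨N, τ, hτ, hτL, rfl⟩ := hx
  obtain ⟨M, σ, hσ, hσL, rfl⟩ := hy
  set ρ : ℕ → ℝ := fun i => if i ≤ N then τ i else σ (i - N) with hρ
  have left : ∀ i ≤ N, ρ i = τ i := fun i hi => if_pos hi
  have right : ∀ i, ρ (N + i) = σ i := by
    intro i
    rcases Nat.eq_zero_or_pos i with rfl | hi
    · rw [Nat.add_zero, left N le_rfl, hτ.2.1, hσ.1]
    · simp [hρ, hi.ne']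
  have step : ∀ P : ℝ → ℝ → Prop, (∀ i < N, P (τ i) (τ (i + 1))) →
      (∀ i < M, P (σ i) (σ (i + 1))) → ∀ i < N + M, P (ρ i) (ρ (i + 1)) := by
    intro P h₁ h₂ i hi
    rcases lt_or_ge i N with h | h
    · rw [left i h.le, left (i + 1) h]
      exact h₁ i h
    · obtain ⟨j, rfl⟩ := Nat.exists_eq_add_of_le h
      rw [right j, Nat.add_assoc, right (j + 1)]
      exact h₂ j (by omega)
  refine ⟨N + M, ρ, ⟨(left 0 (Nat.zero_le _)).trans hτ.1, (right M).trans hσ.2.1,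
    step (· < ·) hτ.2.2 hσ.2.2⟩, step (ωb · · ≤ L) hτL hσL, ?_⟩
  unfold pSum
  rw [Finset.sum_range_add]
  congr 1
  · refine Finset.sum_congr rfl fun i hi => ?_
    have := Finset.mem_range.1 hi
    rw [left i this.le, left (i + 1) this]
  · refine Finset.sum_congr rfl fun i _ => ?_
    rw [right i, Nat.add_assoc, right (i + 1)]

/-- Every subinterval of `[0, T]` has an admissible partition. -/
theorem locVarSet_nonempty {V : Type*} [NormedAddCommGroup V] (g : ℝ → ℝ → V) (p : ℝ) {T : ℝ}
    {ωb : ℝ → ℝ → ℝ} (hωb : IsControl T ωb) {L : ℝ} (hL : 0 < L) {a b : ℝ}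
    (ha : 0 ≤ a) (hab : a ≤ b) (hb : b ≤ T) : (locVarSet g p ωb L a b).Nonempty := by
  rcases hab.eq_or_lt with rfl | hlt
  · exact ⟨_, 0, fun _ => a, ⟨rfl, rfl, by simp⟩, by simp [IsAdmissible], rfl⟩
  obtain ⟨δ, hδ, hunif⟩ := Metric.uniformContinuousOn_iff.1
    ((isCompact_simplex T).uniformContinuousOn_of_continuous hωb.cont) L hL
  obtain ⟨n, hn⟩ := exists_nat_gt ((b - a) / δ)
  have hn0 : (0 : ℝ) < n := (div_pos (sub_pos.2 hlt) hδ).trans hn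
  have hstep : 0 < (b - a) / n := div_pos (sub_pos.2 hlt) hn0
  have hstepδ : (b - a) / n < δ := by
    rw [div_lt_iff₀ hn0, mul_comm]
    exact (div_lt_iff₀ hδ).1 hn
  have hpart : IsPartition a b n fun i => a + i * ((b - a) / n) := by
    refine ⟨by simp, ?_, fun i _ => ?_⟩
    · have := hn0.ne'
      field_simp
      ring
    · push_cast
      linarith
  refine ⟨_, n, _, hpart, fun i hi => ?_, rfl⟩
  have h₁ := ha.trans (hpart.left_le hi.le)
  have h₂ := (hpart.2.2 i hi).le
  have h₃ := (hpart.le_right (i := i + 1) hi).trans hb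
  refine (lt_of_abs_lt ?_).le
  have hdist := hunif (_, _) ⟨h₁, h₂, h₃⟩ (_, _) ⟨h₁, le_rfl, h₂.trans h₃⟩ ?_
  · simpa only [Real.dist_eq, hωb.diag h₁ (h₂.trans h₃), sub_zero] using hdist
  · rw [Prod.dist_eq, dist_self, Real.dist_eq, max_lt_iff]
    refine ⟨hδ, ?_⟩
    rw [abs_of_nonneg (sub_nonneg.2 h₂)]
    push_cast
    linarith

theorem bddAbove_locVarSet {V : Type*} [NormedAddCommGroup V] {g : ℝ → ℝ → V} {p T : ℝ}
    {ωb : ℝ → ℝ → ℝ} (hωb : IsControl T ωb) {L : ℝ} (hL : 0 < L)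
    (hg : BddAbove (locVarSet g p ωb L 0 T)) {s t : ℝ} (hs : 0 ≤ s) (hst : s ≤ t)
    (ht : t ≤ T) : BddAbove (locVarSet g p ωb L s t) := by
  obtain ⟨C, hC⟩ := hg
  obtain ⟨x, hx⟩ := locVarSet_nonempty g p hωb hL le_rfl hs (hst.trans ht)
  obtain ⟨z, hz⟩ := locVarSet_nonempty g p hωb hL (hs.trans hst) ht le_rfl
  refine ⟨C, fun y hy => ?_⟩
  have := hC (add_mem_locVarSet (add_mem_locVarSet hx hy) hz)
  linarith [nonneg_of_mem_locVarSet hx, nonneg_of_mem_locVarSet hz]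

theorem rpow_norm_mem_locVarSet {V : Type*} [NormedAddCommGroup V] (g : ℝ → ℝ → V) (p : ℝ)
    {ωb : ℝ → ℝ → ℝ} {L s t : ℝ} (hst : s < t) (h : ωb s t ≤ L) :
    ‖g s t‖ ^ p ∈ locVarSet g p ωb L s t := by
  refine ⟨1, fun i => if i = 0 then s else t, ⟨by simp, by simp, ?_⟩, ?_, by simp [pSum]⟩
  · simpa using hst
  · simpa [IsAdmissible] using h

theorem IsControl.sum_le {T : ℝ} {ω : ℝ → ℝ → ℝ} (hω : IsControl T ω) {s t : ℝ} (hs : 0 ≤ s)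
    (ht : t ≤ T) {N : ℕ} {τ : ℕ → ℝ} (hτ : IsPartition s t N τ) :
    ∑ i ∈ Finset.range N, ω (τ i) (τ (i + 1)) ≤ ω s t := by
  have key : ∀ k ≤ N, ∑ i ∈ Finset.range k, ω (τ i) (τ (i + 1)) ≤ ω s (τ k) := by
    intro k
    induction k with
    | zero =>
      intro _
      simpa [hτ.1] using
        hω.nonneg hs le_rfl ((hτ.left_le (Nat.zero_le N)).trans
          ((hτ.le_right (Nat.zero_le N)).trans ht))
    | succ k ih =>
      intro hk
      rw [Finset.sum_range_succ]
      have hk' : k ≤ N := by omega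
      exact (add_le_add_left (ih hk') _).trans
        (hω.superadd hs (hτ.left_le hk') (hτ.2.2 k hk).le ((hτ.le_right hk).trans ht))
  simpa only [hτ.2.1] using key N le_rfl

/-- `ω_g(s,t) := ‖g‖_{p,(ω̄,L),[s,t]}^p` bounds the increments of `g`
on intervals with `ω̄(s,t) ≤ L`, and it is the smallest control doing so. -/
theorem statement1 {V : Type*} [NormedAddCommGroup V] [NormedSpace ℝ V] [CompleteSpace V]
    (T : ℝ) (hT : 0 < T) (p : ℝ) (hp : 0 < p)
    (ωb : ℝ → ℝ → ℝ) (hωb : IsControl T ωb) (L : ℝ) (hL : 0 < L)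
    (g : ℝ → ℝ → V)
    (hgc : ContinuousOn (fun q : ℝ × ℝ => g q.1 q.2) (Simplex T))
    (hgd : ∀ s : ℝ, 0 ≤ s → s ≤ T → g s s = 0)
    (hgfin : BddAbove (locVarSet g p ωb L 0 T)) :
    (∀ s t : ℝ, (s, t) ∈ Simplex T → ωb s t ≤ L →
      ‖g s t‖ ≤ locVar g p ωb L s t ^ (1 / p)) ∧
    (∀ ω : ℝ → ℝ → ℝ, IsControl T ω →
      (∀ s t : ℝ, (s, t) ∈ Simplex T → ωb s t ≤ L → ‖g s t‖ ≤ ω s t ^ (1 / p)) →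
      ∀ u v : ℝ, (u, v) ∈ Simplex T → locVar g p ωb L u v ≤ ω u v) := by
  refine ⟨fun s t ⟨hs, hst, ht⟩ hL' => ?_, fun ω hω h u v ⟨hu, huv, hv⟩ => ?_⟩
  · rcases (show s ≤ t from hst).eq_or_lt with rfl | hlt
    · rw [hgd s hs ht, norm_zero]
      exact Real.rpow_nonneg (locVar_nonneg g p ωb L s s) _
    · rw [one_div, Real.le_rpow_inv_iff_of_pos (norm_nonneg _) (locVar_nonneg g p ωb L s t) hp]
      exact le_csSup (bddAbove_locVarSet hωb hL hgfin hs hst ht)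
        (rpow_norm_mem_locVarSet g p hlt hL')
  · refine Real.sSup_le ?_ (hω.nonneg hu huv hv)
    rintro _ ⟨N, τ, hτ, hτL, rfl⟩
    refine le_trans (Finset.sum_le_sum fun i hi => ?_) (hω.sum_le hu hv hτ)
    have hiN := Finset.mem_range.1 hi
    have h₁ := hu.trans (hτ.left_le hiN.le)
    have h₂ := (hτ.2.2 i hiN).le
    have h₃ := (hτ.le_right (i := i + 1) hiN).trans hv
    rw [← Real.le_rpow_inv_iff_of_pos (norm_nonneg _) (hω.nonneg h₁ h₂ h₃) hp, ← one_div]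
    exact h _ _ ⟨h₁, h₂, h₃⟩ (hτL i hiN)
end

section
/- Let V be a Banach space, p ≥ 1, ω̄ a control on Δ_T with ω̄(0,T) > 0, and L > 0. Let g : [0,T] → V be a continuous function with finite localized p-variation with respect to (ω̄,L). Then g has finite (unlocalized) p-variation on [0,T], and there exists a constant C > 0 depending only on p such that ‖g‖_{p,[0,T]}^p ≤ C (1 + ω̄(0,T)/L)^{p−1} ‖g‖_{p,(ω̄,L),[0,T]}^p. In particular, the space of continuous paths of finite localized p-variation coincides with the space of continuous paths of finite p-variation. -/
open Set

theorem isPartition_single {a b : ℝ} (h : a < b) :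
    IsPartition a b 1 (fun i => if i = 0 then a else b) := by
  refine ⟨by simp, by simp, fun i hi => ?_⟩
  obtain rfl : i = 0 := by omega
  simpa using h

/-- Follow `τ` for `N` steps, then `σ`. -/
def concatPartition (N : ℕ) (τ σ : ℕ → ℝ) : ℕ → ℝ :=
  fun i => if i < N then τ i else σ (i - N)

theorem concatPartition_of_le {N : ℕ} {τ σ : ℕ → ℝ} (h : τ N = σ 0) {i : ℕ} (hi : i ≤ N) :
    concatPartition N τ σ i = τ i := by
  unfold concatPartition
  split_ifs with h'
  · rfl
  · obtain rfl : i = N := by omega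
    simp [h]

theorem concatPartition_add (N : ℕ) (τ σ : ℕ → ℝ) (i : ℕ) :
    concatPartition N τ σ (N + i) = σ i := by
  simp [concatPartition]

theorem concatPartition_step {N M : ℕ} {τ σ : ℕ → ℝ} (h : τ N = σ 0) {P : ℝ → ℝ → Prop}
    (hτ : ∀ i < N, P (τ i) (τ (i + 1))) (hσ : ∀ i < M, P (σ i) (σ (i + 1))) :
    ∀ i < N + M, P (concatPartition N τ σ i) (concatPartition N τ σ (i + 1)) := by
  intro i hi
  rcases lt_or_ge i N with hiN | hiN
  · rw [concatPartition_of_le h hiN.le, concatPartition_of_le h hiN]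
    exact hτ i hiN
  · obtain ⟨j, rfl⟩ := Nat.exists_eq_add_of_le hiN
    rw [add_assoc, concatPartition_add, concatPartition_add]
    exact hσ j (by omega)

theorem IsPartition.concat {s u t : ℝ} {N M : ℕ} {τ σ : ℕ → ℝ}
    (hτ : IsPartition s u N τ) (hσ : IsPartition u t M σ) :
    IsPartition s t (N + M) (concatPartition N τ σ) := by
  have h : τ N = σ 0 := hτ.2.1.trans hσ.1.symm
  exact ⟨by rw [concatPartition_of_le h N.zero_le, hτ.1],
    by rw [concatPartition_add, hσ.2.1], concatPartition_step h hτ.2.2 hσ.2.2⟩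

theorem pSum_concatPartition {V : Type*} [NormedAddCommGroup V] (g : ℝ → ℝ → V) (p : ℝ)
    {N : ℕ} {τ σ : ℕ → ℝ} (h : τ N = σ 0) (M : ℕ) :
    pSum g p (N + M) (concatPartition N τ σ) = pSum g p N τ + pSum g p M σ := by
  unfold pSum
  rw [Finset.sum_range_add]
  congr 1
  · refine Finset.sum_congr rfl fun i hi => ?_
    have hi' := Finset.mem_range.1 hi
    rw [concatPartition_of_le h hi'.le, concatPartition_of_le h hi']
  · simp only [add_assoc, concatPartition_add]

/-- Subdivide greedily, cutting off intervals on which the control equals `L`. -/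
theorem IsControl.exists_admissible_of_le_mul {T : ℝ} {ωb : ℝ → ℝ → ℝ} (hω : IsControl T ωb)
    {L : ℝ} (hL : 0 < L) {b : ℝ} (hbT : b ≤ T) (n : ℕ) :
    ∀ {a : ℝ}, 0 ≤ a → a < b → ωb a b ≤ (n + 1) * L →
      ∃ N τ, N ≤ n + 1 ∧ IsPartition a b N τ ∧ IsAdmissible ωb L N τ := by
  have single : ∀ {a c : ℝ}, ωb a c ≤ L →
      IsAdmissible ωb L 1 (fun i => if i = 0 then a else c) := by
    intro a c h i hi
    obtain rfl : i = 0 := by omega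
    simpa using h
  induction n with
  | zero =>
    intro a _ hab h
    exact ⟨1, _, le_rfl, isPartition_single hab, single (by simpa using h)⟩
  | succ n ih =>
    intro a ha hab h
    rcases le_or_gt (ωb a b) L with hle | hgt
    · exact ⟨1, _, by omega, isPartition_single hab, single hle⟩
    have hcont : ContinuousOn (fun c => ωb a c) (Icc a b) :=
      hω.cont.comp (f := fun c : ℝ => (a, c)) (by fun_prop)
        fun c hc => ⟨ha, hc.1, hc.2.trans hbT⟩
    have haa : ωb a a = 0 := hω.diag ha (hab.le.trans hbT)
    obtain ⟨c, hc, hcL⟩ := intermediate_value_Icc hab.le hcont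
      (show L ∈ Icc (ωb a a) (ωb a b) from ⟨haa ▸ hL.le, hgt.le⟩)
    replace hcL : ωb a c = L := hcL
    have hac : a < c := hc.1.lt_of_ne (by rintro rfl; linarith)
    have hcb : c < b := hc.2.lt_of_ne (by rintro rfl; linarith)
    have hsup := hω.superadd ha hac.le hcb.le hbT
    push_cast at h
    obtain ⟨N, τ, hN, hτ, hτL⟩ := ih (ha.trans hac.le) hcb (by linarith)
    have hP := isPartition_single hac
    exact ⟨1 + N, _, by omega, hP.concat hτ,
      concatPartition_step (P := fun a b => ωb a b ≤ L) (hP.2.1.trans hτ.1.symm)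
        (single hcL.le) hτL⟩

theorem IsControl.exists_admissible {T : ℝ} {ωb : ℝ → ℝ → ℝ} (hω : IsControl T ωb)
    {L : ℝ} (hL : 0 < L) {a b : ℝ} (ha : 0 ≤ a) (hab : a < b) (hbT : b ≤ T) :
    ∃ (N : ℕ) (τ : ℕ → ℝ), (N : ℝ) ≤ 1 + ωb 0 T / L ∧ IsPartition a b N τ ∧
      IsAdmissible ωb L N τ := by
  obtain ⟨N, τ, hN, h⟩ := hω.exists_admissible_of_le_mul hL hbT ⌊ωb a b / L⌋₊ ha hab
    ((div_le_iff₀ hL).1 (Nat.lt_floor_add_one _).le)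
  refine ⟨N, τ, ?_, h⟩
  have hfl := Nat.floor_le (div_nonneg (hω.nonneg ha hab.le hbT) hL.le)
  have hmono : ωb a b ≤ ωb 0 T := by
    have h₁ := hω.superadd ha hab.le hbT le_rfl
    have h₂ := hω.superadd le_rfl ha (hab.le.trans hbT) le_rfl
    have h₃ := hω.nonneg (ha.trans hab.le) hbT le_rfl
    have h₄ := hω.nonneg le_rfl ha (hab.le.trans hbT)
    linarith
  have hN' : (N : ℝ) ≤ ⌊ωb a b / L⌋₊ + 1 := by exact_mod_cast hN
  have := div_le_div_of_nonneg_right hmono hL.le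
  linarith

theorem norm_inc_rpow_le_pSum {V : Type*} [NormedAddCommGroup V] (f : ℝ → V) {p : ℝ}
    (hp : 1 ≤ p) (N : ℕ) (τ : ℕ → ℝ) :
    ‖inc f (τ 0) (τ N)‖ ^ p ≤ (N : ℝ) ^ (p - 1) * pSum (inc f) p N τ := by
  have h : ‖inc f (τ 0) (τ N)‖ ≤ ∑ i ∈ Finset.range N, ‖inc f (τ i) (τ (i + 1))‖ := by
    unfold inc
    rw [← Finset.sum_range_sub (fun i => f (τ i))]
    exact norm_sum_le _ _
  calc ‖inc f (τ 0) (τ N)‖ ^ p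
      ≤ (∑ i ∈ Finset.range N, ‖inc f (τ i) (τ (i + 1))‖) ^ p := by gcongr
    _ ≤ _ := by
      simpa [pSum] using Real.rpow_sum_le_const_mul_sum_rpow_of_nonneg (Finset.range N)
        hp (fun i _ => norm_nonneg (inc f (τ i) (τ (i + 1))))

/-- Every partition of `[s,t]` can be compared with an admissible one. -/
theorem IsControl.exists_mem_locVarSet {V : Type*} [NormedAddCommGroup V] (f : ℝ → V) {p : ℝ}
    (hp : 1 ≤ p) {T : ℝ} {ωb : ℝ → ℝ → ℝ} (hω : IsControl T ωb) {L : ℝ} (hL : 0 < L)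
    {s : ℝ} (hs : 0 ≤ s) (τ : ℕ → ℝ) (N : ℕ) :
    ∀ {t : ℝ}, t ≤ T → IsPartition s t N τ → s ≤ t ∧ ∃ x ∈ locVarSet (inc f) p ωb L s t,
      pSum (inc f) p N τ ≤ (1 + ωb 0 T / L) ^ (p - 1) * x := by
  induction N with
  | zero =>
    intro t _ h
    exact ⟨(h.1.symm.trans h.2.1).le, 0,
      ⟨0, τ, h, fun i hi => absurd hi i.not_lt_zero, by simp [pSum]⟩, by simp [pSum]⟩
  | succ N ih =>
    intro t htT h
    have hlt : τ N < t := h.2.1 ▸ h.2.2 N N.lt_succ_self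
    obtain ⟨hsN, x, hx, hxle⟩ := ih (hlt.le.trans htT)
      ⟨h.1, rfl, fun i hi => h.2.2 i (hi.trans N.lt_succ_self)⟩
    obtain ⟨M, σ, hM, hσ, hσL⟩ := hω.exists_admissible hL (hs.trans hsN) hlt htT
    refine ⟨hsN.trans hlt.le, x + pSum (inc f) p M σ,
      add_mem_locVarSet hx ⟨M, σ, hσ, hσL, rfl⟩, ?_⟩
    have hstep := norm_inc_rpow_le_pSum f hp M σ
    rw [hσ.1, hσ.2.1] at hstep
    have hpow : (M : ℝ) ^ (p - 1) ≤ (1 + ωb 0 T / L) ^ (p - 1) :=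
      Real.rpow_le_rpow M.cast_nonneg hM (by linarith)
    have := mul_le_mul_of_nonneg_right hpow (pSum_nonneg (inc f) p M σ)
    have hsucc : pSum (inc f) p (N + 1) τ = pSum (inc f) p N τ + ‖inc f (τ N) t‖ ^ p := by
      unfold pSum
      rw [Finset.sum_range_succ, h.2.1]
    rw [hsucc, mul_add]
    linarith

/-- A continuous path of finite localized `p`-variation has finite
(unlocalized) `p`-variation, with the quantitative bound
`‖g‖_{p,[0,T]}^p ≤ C (1 + ω̄(0,T)/L)^(p-1) ‖g‖_{p,(ω̄,L),[0,T]}^p`,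
where `C > 0` depends only on `p`. -/
theorem statement3 (p : ℝ) (hp : 1 ≤ p) :
    ∃ C : ℝ, 0 < C ∧
      ∀ (V : Type*) [NormedAddCommGroup V] [NormedSpace ℝ V] [CompleteSpace V],
        ∀ T : ℝ, 0 < T → ∀ ωb : ℝ → ℝ → ℝ, IsControl T ωb → 0 < ωb 0 T →
          ∀ L : ℝ, 0 < L → ∀ g : ℝ → V, ContinuousOn g (Icc 0 T) →
            BddAbove (locVarSet (inc g) p ωb L 0 T) →
              BddAbove (varSet (inc g) p 0 T) ∧
              pVar (inc g) p 0 T ≤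
                C * (1 + ωb 0 T / L) ^ (p - 1) * locVar (inc g) p ωb L 0 T := by
  refine ⟨1, one_pos, ?_⟩
  intro V _ _ _ T hT ωb hω hωT L hL g _ hbdd
  have hbound : ∀ x ∈ varSet (inc g) p 0 T,
      x ≤ 1 * (1 + ωb 0 T / L) ^ (p - 1) * locVar (inc g) p ωb L 0 T := by
    rintro x ⟨N, τ, hτ, rfl⟩
    obtain ⟨-, y, hy, hle⟩ := hω.exists_mem_locVarSet g hp hL le_rfl τ N le_rfl hτ
    rw [one_mul]
    exact hle.trans (mul_le_mul_of_nonneg_left (le_csSup hbdd hy) (by positivity))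
  exact ⟨⟨_, hbound⟩, csSup_le ⟨_, 1, _, isPartition_single hT, rfl⟩ hbound⟩
end

section
/- Let ω be a control on Δ_T and let c > 0 satisfy c < ω(0,T). Then there exist N ∈ ℕ and a partition 0 = t_0 < t_1 < ⋯ < t_N = T such that ω(t_{j−1}, t_j) = c for all j ∈ {1, …, N−1} and ω(t_{N−1}, t_N) ≤ c. Moreover, N satisfies (N−1) c ≤ ω(0,T). -/
open Set

/-- If `ω s T` exceeds `c > 0`, some intermediate point `u` satisfies `ω s u = c`. -/
theorem IsControl.exists_eq {T : ℝ} {ω : ℝ → ℝ → ℝ} (hω : IsControl T ω) {c s : ℝ}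
    (hc : 0 < c) (hs : 0 ≤ s) (hsT : s ≤ T) (h : c < ω s T) :
    ∃ u, s < u ∧ u < T ∧ ω s u = c := by
  have hcont : ContinuousOn (fun u => ω s u) (Set.Icc s T) :=
    hω.cont.comp (f := fun u : ℝ => (s, u)) (by fun_prop)
      fun u hu => ⟨hs, hu.1, hu.2⟩
  obtain ⟨u, hu, huc⟩ := intermediate_value_Icc hsT hcont
    ⟨(hω.diag hs hsT).le.trans hc.le, h.le⟩
  have huc : ω s u = c := huc
  refine ⟨u, lt_of_le_of_ne hu.1 ?_, lt_of_le_of_ne hu.2 ?_, huc⟩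
  · rintro rfl
    exact hc.ne (hω.diag hs hsT ▸ huc)
  · rintro rfl
    exact h.ne huc.symm

/-- Greedy partition of `[s, T]` with steps of `ω`-size `c`, by induction on an upper bound
for the number of full steps. -/
theorem IsControl.exists_greedy_partition {T : ℝ} {ω : ℝ → ℝ → ℝ} (hω : IsControl T ω) {c : ℝ}
    (hc : 0 < c) (m : ℕ) : ∀ s : ℝ, 0 ≤ s → s < T → ω s T ≤ m * c →
    ∃ N : ℕ, ∃ τ : ℕ → ℝ, IsPartition s T (N + 1) τ ∧
      (∀ j < N, ω (τ j) (τ (j + 1)) = c) ∧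
      ω (τ N) (τ (N + 1)) ≤ c ∧ N * c ≤ ω s T := by
  have single : ∀ s : ℝ, 0 ≤ s → s < T → ω s T ≤ c →
      ∃ N : ℕ, ∃ τ : ℕ → ℝ, IsPartition s T (N + 1) τ ∧
        (∀ j < N, ω (τ j) (τ (j + 1)) = c) ∧
        ω (τ N) (τ (N + 1)) ≤ c ∧ N * c ≤ ω s T := by
    intro s hs hsT h
    refine ⟨0, fun n => Nat.casesOn n s fun _ => T, ⟨rfl, rfl, ?_⟩, by simp, h, ?_⟩
    · intro i hi
      obtain rfl : i = 0 := by omega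
      exact hsT
    · simpa using hω.nonneg hs hsT.le le_rfl
  induction m with
  | zero =>
    intro s hs hsT h
    refine single s hs hsT (h.trans ?_)
    simpa using hc.le
  | succ m ih =>
    intro s hs hsT h
    rcases le_or_gt (ω s T) c with hle | hgt
    · exact single s hs hsT hle
    obtain ⟨u, hsu, huT, huc⟩ := hω.exists_eq hc hs hsT.le hgt
    have hadd := hω.superadd hs hsu.le huT.le le_rfl
    push_cast at h
    obtain ⟨N, τ, ⟨h0, hN, hlt⟩, heq, hlast, hcard⟩ :=
      ih u (hs.trans hsu.le) huT (by linarith)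
    refine ⟨N + 1, fun n => Nat.casesOn n s τ, ⟨rfl, hN, ?_⟩, ?_, hlast, ?_⟩
    · rintro (_ | i) hi
      · exact hsu.trans_eq h0.symm
      · exact hlt i (by omega)
    · rintro (_ | j) hj
      · exact (congrArg (ω s) h0).trans huc
      · exact heq j (by omega)
    · push_cast
      linarith

/-- A control `ω` with `ω(0,T) > c > 0` admits a partition
`0 = t_0 < t_1 < ⋯ < t_N = T` with `ω(t_{j-1}, t_j) = c` for `j = 1, …, N-1` and
`ω(t_{N-1}, t_N) ≤ c`; moreover `(N-1) c ≤ ω(0,T)`. -/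
theorem statement9 (T : ℝ) (hT : 0 ≤ T) (ω : ℝ → ℝ → ℝ) (hω : IsControl T ω)
    (c : ℝ) (hc : 0 < c) (hcT : c < ω 0 T) :
    ∃ N : ℕ, ∃ τ : ℕ → ℝ, 1 ≤ N ∧ IsPartition 0 T N τ ∧
      (∀ j : ℕ, j + 1 < N → ω (τ j) (τ (j + 1)) = c) ∧
      ω (τ (N - 1)) (τ N) ≤ c ∧
      ((N : ℝ) - 1) * c ≤ ω 0 T := by
  have hT0 : 0 < T := by
    refine hT.lt_of_ne ?_
    rintro rfl
    linarith [hω.diag le_rfl le_rfl]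
  obtain ⟨m, hm⟩ := exists_nat_ge (ω 0 T / c)
  obtain ⟨N, τ, hpart, heq, hlast, hcard⟩ :=
    hω.exists_greedy_partition hc m 0 le_rfl hT0 ((div_le_iff₀ hc).1 hm)
  exact ⟨N + 1, τ, by omega, hpart, fun j hj => heq j (by omega), hlast, by simpa using hcard⟩
end

section
/- Let V be a Banach space and let F : Δ_T → V be a continuous two-index function which is additive, i.e. F(s,t) = F(s,u) + F(u,t) for all 0 ≤ s ≤ u ≤ t ≤ T. Suppose that F has finite q-variation for some q ∈ (0,1), i.e. sup over all partitions 0 = t_0 < t_1 < ⋯ < t_N = T of Σ_i ‖F(t_i,t_{i+1})‖^q is finite. Then F(s,t) = 0 for all (s,t) ∈ Δ_T. -/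
open Set

/-- For `q ≤ 1`, a sum of nonnegative numbers bounded by `ε` is controlled by the sum of their
`q`-th powers. -/
theorem sum_le_rpow_mul_sum_rpow {ι : Type*} (s : Finset ι) (a : ι → ℝ) {ε q : ℝ} (hq : q ≤ 1)
    (ha : ∀ i ∈ s, 0 ≤ a i) (hε : ∀ i ∈ s, a i ≤ ε) :
    ∑ i ∈ s, a i ≤ ε ^ (1 - q) * ∑ i ∈ s, a i ^ q := by
  rw [Finset.mul_sum]
  refine Finset.sum_le_sum fun i hi => ?_
  calc a i = a i ^ (1 - q) * a i ^ q := by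
        rw [← Real.rpow_add' (ha i hi) (by norm_num)]
        norm_num
    _ ≤ ε ^ (1 - q) * a i ^ q := by
        gcongr
        · exact Real.rpow_nonneg (ha i hi) q
        · exact ha i hi
        · exact hε i hi

/-- The `q`-sum along a partition of `[s,t]` is bounded by any bound for the `q`-sums along
partitions of a larger interval `[s,T]`. -/
theorem pSum_le_of_mem_upperBounds {V : Type*} [NormedAddCommGroup V] {F : ℝ → ℝ → V}
    {q s t T M : ℝ} (hM : M ∈ upperBounds (varSet F q s T)) (htT : t ≤ T) {N : ℕ} {τ : ℕ → ℝ}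
    (hτ : IsPartition s t N τ) : pSum F q N τ ≤ M := by
  obtain ⟨h0, hN, hlt⟩ := hτ
  rcases htT.eq_or_lt with rfl | htT
  · exact hM ⟨N, τ, ⟨h0, hN, hlt⟩, rfl⟩
  · let σ : ℕ → ℝ := fun i => if i ≤ N then τ i else T
    have hσ : ∀ i ≤ N, σ i = τ i := fun i hi => if_pos hi
    have hσN : σ (N + 1) = T := if_neg (by omega)
    have hpart : IsPartition s T (N + 1) σ := by
      refine ⟨by rw [hσ 0 (Nat.zero_le N), h0], hσN, fun i hi => ?_⟩
      rcases (Nat.lt_succ_iff.mp hi).eq_or_lt with rfl | hi'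
      · rw [hσ i le_rfl, hσN, hN]
        exact htT
      · rw [hσ i hi'.le, hσ (i + 1) hi']
        exact hlt i hi'
    have hsum : pSum F q N τ = ∑ i ∈ Finset.range N, ‖F (σ i) (σ (i + 1))‖ ^ q :=
      Finset.sum_congr rfl fun i hi => by
        have hi' := Finset.mem_range.mp hi
        rw [hσ i hi'.le, hσ (i + 1) hi']
    refine le_trans ?_ (hM ⟨N + 1, σ, hpart, rfl⟩)
    rw [hsum, pSum, Finset.sum_range_succ]
    exact le_add_of_nonneg_right (Real.rpow_nonneg (norm_nonneg _) q)

/-- A continuous path whose `q`-sums over all partitions of `[0,t]` are bounded, `q < 1`, has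
equal endpoints. -/
theorem eq_of_pSum_inc_le {V : Type*} [NormedAddCommGroup V] {f : ℝ → V} {q t M : ℝ}
    (hq : q < 1) (ht : 0 < t) (hf : ContinuousOn f (Icc 0 t))
    (hM : ∀ N τ, IsPartition 0 t N τ → pSum (inc f) q N τ ≤ M) : f t = f 0 := by
  have hbound : ∀ ε > 0, ‖f t - f 0‖ ≤ ε ^ (1 - q) * M := by
    intro ε hε
    obtain ⟨δ, hδ, hfδ⟩ := Metric.uniformContinuousOn_iff.mp
      (isCompact_Icc.uniformContinuousOn_of_continuous hf) ε hε
    obtain ⟨n, hn⟩ := exists_nat_gt (t / δ)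
    have hn0 : (0 : ℝ) < n := (div_pos ht hδ).trans hn
    have hstep : t / n < δ := by
      rw [div_lt_iff₀ hδ] at hn
      rw [div_lt_iff₀ hn0]
      linarith
    have hstep0 : 0 < t / n := div_pos ht hn0
    let τ : ℕ → ℝ := fun i => i * (t / n)
    have hτ0 : τ 0 = 0 := by simp [τ]
    have hτn : τ n = t := mul_div_cancel₀ t hn0.ne'
    have hτs : ∀ i, τ (i + 1) = τ i + t / n := fun i => by
      simp only [τ]
      push_cast
      ring
    have hmem : ∀ i ≤ n, τ i ∈ Icc 0 t := fun i hi => by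
      refine ⟨by positivity, ?_⟩
      rw [← hτn]
      exact mul_le_mul_of_nonneg_right (Nat.cast_le.mpr hi) hstep0.le
    have hpart : IsPartition 0 t n τ :=
      ⟨hτ0, hτn, fun i _ => by rw [hτs]; linarith⟩
    calc ‖f t - f 0‖ = ‖∑ i ∈ Finset.range n, inc f (τ i) (τ (i + 1))‖ := by
          simp only [inc]
          rw [Finset.sum_range_sub (fun i => f (τ i)), hτn, hτ0]
      _ ≤ ∑ i ∈ Finset.range n, ‖inc f (τ i) (τ (i + 1))‖ := norm_sum_le _ _
      _ ≤ ε ^ (1 - q) * pSum (inc f) q n τ := by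
          refine sum_le_rpow_mul_sum_rpow _ _ hq.le (fun _ _ => norm_nonneg _) fun i hi => ?_
          have hi' := Finset.mem_range.mp hi
          rw [inc, ← dist_eq_norm]
          refine (hfδ _ (hmem (i + 1) hi') _ (hmem i hi'.le) ?_).le
          rw [hτs, Real.dist_eq, add_sub_cancel_left, abs_of_pos hstep0]
          exact hstep
      _ ≤ ε ^ (1 - q) * M :=
          mul_le_mul_of_nonneg_left (hM n τ hpart) (Real.rpow_nonneg hε.le _)
  have hlim : Filter.Tendsto (fun ε : ℝ => ε ^ (1 - q) * M) (nhdsWithin 0 (Ioi 0)) (nhds 0) := by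
    have h : Filter.Tendsto (fun ε : ℝ => ε ^ (1 - q) * M) (nhds 0)
        (nhds ((0 : ℝ) ^ (1 - q) * M)) :=
      ((Real.continuous_rpow_const (by linarith)).tendsto 0).mul_const M
    rw [Real.zero_rpow (by linarith), zero_mul] at h
    exact h.mono_left nhdsWithin_le_nhds
  have hle : ‖f t - f 0‖ ≤ 0 := ge_of_tendsto hlim (by
    filter_upwards [self_mem_nhdsWithin] with ε hε using hbound ε hε)
  exact sub_eq_zero.mp (norm_le_zero_iff.mp hle)

/-- A continuous additive two-index function of finite `q`-variation for
some `q ∈ (0,1)` vanishes identically. -/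
theorem statement10 {V : Type*} [NormedAddCommGroup V] [NormedSpace ℝ V] [CompleteSpace V]
    (T : ℝ) (hT : 0 < T) (q : ℝ) (hq : q ∈ Set.Ioo (0 : ℝ) 1)
    (F : ℝ → ℝ → V)
    (hFc : ContinuousOn (fun q : ℝ × ℝ => F q.1 q.2) (Simplex T))
    (hadd : ∀ s u t : ℝ, 0 ≤ s → s ≤ u → u ≤ t → t ≤ T → F s t = F s u + F u t)
    (hfin : BddAbove (varSet F q 0 T)) :
    ∀ s t : ℝ, (s, t) ∈ Simplex T → F s t = 0 := by
  obtain ⟨M, hM⟩ := hfin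
  have hinc : ∀ a b, 0 ≤ a → a ≤ b → b ≤ T → F a b = inc (F 0) a b := fun a b ha hab hb => by
    rw [inc, hadd 0 a b le_rfl ha hab hb, add_sub_cancel_left]
  have hF00 : F 0 0 = 0 := by
    simpa [inc] using hinc 0 0 le_rfl le_rfl hT.le
  have hcont : ContinuousOn (F 0) (Icc 0 T) :=
    hFc.comp (f := fun x : ℝ => ((0 : ℝ), x)) (by fun_prop)
      fun x hx => ⟨le_rfl, hx.1, hx.2⟩
  have hzero : ∀ t, 0 ≤ t → t ≤ T → F 0 t = 0 := by
    intro t ht htT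
    rcases ht.eq_or_lt with rfl | ht
    · exact hF00
    rw [← hF00]
    refine eq_of_pSum_inc_le (M := M) hq.2 ht (hcont.mono (Icc_subset_Icc_right htT)) ?_
    intro N τ hτ
    have hmono : ∀ i j, i ≤ j → j ≤ N → τ i ≤ τ j := fun i j hij => by
      induction j, hij using Nat.le_induction with
      | base => exact fun _ => le_rfl
      | succ k _ ih => exact fun hk => (ih (by omega)).trans (hτ.2.2 k hk).le
    refine le_trans (le_of_eq ?_) (pSum_le_of_mem_upperBounds hM htT hτ)
    refine Finset.sum_congr rfl fun i hi => ?_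
    have hi' := Finset.mem_range.mp hi
    rw [hinc (τ i) (τ (i + 1)) (hτ.1 ▸ hmono 0 i (Nat.zero_le i) hi'.le) (hτ.2.2 i hi').le
      ((hmono (i + 1) N hi' le_rfl).trans (hτ.2.1.trans_le htT))]
  rintro s t ⟨hs, hst, ht⟩
  rw [hinc s t hs hst ht, inc, hzero t (hs.trans hst) ht, hzero s hs (hst.trans ht), sub_zero]
end
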